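/- Let 0 < λ < 1. Then, as k → 1⁻, zn(λK(k), k) ~ 1 − λ − 2(k'/4)^{2λ}, in the sense that ((1 − λ) − zn(λK(k), k)) / (2(k'/4)^{2λ}) tends to 1 as k → 1⁻, where k' = √(1−k²). -/

import Mathlib

open Real

/-- Complete elliptic integral of the first kind. -/
noncomputable def EllK (k : ℝ) : ℝ :=
  ∫ θ in (0:ℝ)..(π/2), 1 / Real.sqrt (1 - k^2 * Real.sin θ ^ 2)

/-- Complete elliptic integral of the second kind. -/
noncomputable def EllE (k : ℝ) : ℝ :=
  ∫ θ in (0:ℝ)..(π/2), Real.sqrt (1 - k^2 * Real.sin θ ^ 2)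

/-- Complementary complete elliptic integral `K'(k) = K(√(1-k²))`. -/
noncomputable def EllK' (k : ℝ) : ℝ := EllK (Real.sqrt (1 - k^2))

/-- Complementary elliptic integral of the second kind `E'(k) = E(√(1-k²))`. -/
noncomputable def EllE' (k : ℝ) : ℝ := EllE (Real.sqrt (1 - k^2))

/-- The nome `q = exp(-π K'(k)/K(k))`. -/
noncomputable def nome (k : ℝ) : ℝ := Real.exp (-π * EllK' k / EllK k)

/-- Jacobi's theta function `Θ(u,k) = 1 + 2 ∑_{n≥1} (-1)^n q^{n²} cos(nπu/K)`. -/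
noncomputable def JTheta (u k : ℝ) : ℝ :=
  1 + 2 * ∑' n : ℕ, (-1 : ℝ)^(n+1) * nome k ^ ((n+1)^2) *
    Real.cos (((n:ℝ)+1) * π * u / EllK k)

/-- Jacobi's theta function `H(u,k) = 2 ∑_{n≥0} (-1)^n q^{(n+1/2)²} sin((2n+1)πu/(2K))`. -/
noncomputable def JH (u k : ℝ) : ℝ :=
  2 * ∑' n : ℕ, (-1 : ℝ)^n * nome k ^ ((((n:ℝ) + 1/2)^2)) *
    Real.sin ((2*(n:ℝ)+1) * π * u / (2 * EllK k))

/-- Jacobi's theta function `H₁(u,k) = 2 ∑_{n≥0} q^{(n+1/2)²} cos((2n+1)πu/(2K))`. -/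
noncomputable def JH1 (u k : ℝ) : ℝ :=
  2 * ∑' n : ℕ, nome k ^ ((((n:ℝ) + 1/2)^2)) *
    Real.cos ((2*(n:ℝ)+1) * π * u / (2 * EllK k))

/-- Jacobi's theta function `Θ₁(u,k) = 1 + 2 ∑_{n≥1} q^{n²} cos(nπu/K)`. -/
noncomputable def JTheta1 (u k : ℝ) : ℝ :=
  1 + 2 * ∑' n : ℕ, nome k ^ ((n+1)^2) * Real.cos (((n:ℝ)+1) * π * u / EllK k)

/-- Jacobi's zeta function `zn(u,k) = Θ_u(u,k)/Θ(u,k)`. -/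
noncomputable def zn (u k : ℝ) : ℝ := deriv (fun v => JTheta v k) u / JTheta u k

/-- Jacobi's elliptic sine `sn(u,k) = H(u,k)/(√k Θ(u,k))`. -/
noncomputable def sn (u k : ℝ) : ℝ := JH u k / (Real.sqrt k * JTheta u k)

/-- Jacobi's elliptic cosine `cn(u,k) = √(k'/k) H₁(u,k)/Θ(u,k)`. -/
noncomputable def cn (u k : ℝ) : ℝ :=
  Real.sqrt (Real.sqrt (1 - k^2) / k) * JH1 u k / JTheta u k

/-- Jacobi's delta amplitude `dn(u,k) = √(k') Θ₁(u,k)/Θ(u,k)`. -/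
noncomputable def dn (u k : ℝ) : ℝ :=
  Real.sqrt (Real.sqrt (1 - k^2)) * JTheta1 u k / JTheta u k

open Filter Topology MeasureTheory HurwitzZeta

lemma one_sub_sq_mul_sin_sq_pos {k : ℝ} (hk : 0 < k) (hk' : k < 1) (θ : ℝ) :
    0 < 1 - k ^ 2 * sin θ ^ 2 := by
  nlinarith [sin_sq_le_one θ, sq_nonneg (sin θ)]

lemma continuous_one_div_sqrt_one_sub_sq_mul_sin_sq {k : ℝ} (hk : 0 < k) (hk' : k < 1) :
    Continuous fun θ : ℝ => 1 / √(1 - k ^ 2 * sin θ ^ 2) := by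
  refine continuous_const.div (by fun_prop) fun θ => ?_
  exact (sqrt_pos.2 (one_sub_sq_mul_sin_sq_pos hk hk' θ)).ne'

lemma pi_div_two_le_EllK {k : ℝ} (hk : 0 < k) (hk' : k < 1) : π / 2 ≤ EllK k := by
  have h : ∫ _ in (0 : ℝ)..(π / 2), (1 : ℝ) = π / 2 := by simp
  rw [← h, EllK]
  refine intervalIntegral.integral_mono_on (by positivity) (by simp)
    ((continuous_one_div_sqrt_one_sub_sq_mul_sin_sq hk hk').intervalIntegrable _ _) fun θ _ => ?_
  rw [le_div_iff₀ (sqrt_pos.2 (one_sub_sq_mul_sin_sq_pos hk hk' θ)), one_mul, sqrt_le_one]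
  nlinarith [sq_nonneg (k * sin θ)]

lemma EllK_le {k : ℝ} (hk : 0 < k) (hk' : k < 1) : EllK k ≤ π / 2 / √(1 - k ^ 2) := by
  have h : ∫ _ in (0 : ℝ)..(π / 2), 1 / √(1 - k ^ 2) = π / 2 / √(1 - k ^ 2) := by
    simp [div_eq_mul_inv]
  rw [← h, EllK]
  refine intervalIntegral.integral_mono_on (by positivity)
    ((continuous_one_div_sqrt_one_sub_sq_mul_sin_sq hk hk').intervalIntegrable _ _) (by simp)
    fun θ _ => ?_
  have : 0 < 1 - k ^ 2 := by nlinarith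
  refine one_div_le_one_div_of_le (sqrt_pos.2 this) (sqrt_le_sqrt ?_)
  nlinarith [sin_sq_le_one θ, sq_nonneg k]

lemma integral_sin_div_sqrt {k : ℝ} (hk : 0 < k) (hk' : k < 1) :
    ∫ θ in (0 : ℝ)..(π / 2), sin θ / √(1 - k ^ 2 * sin θ ^ 2) =
      1 / k * log ((1 + k) / √(1 - k ^ 2)) := by
  have hs : 0 < 1 - k ^ 2 := by nlinarith
  set κ := √(1 - k ^ 2) with hκ
  have hκ0 : 0 < κ := sqrt_pos.2 hs
  have hκ2 : κ ^ 2 = 1 - k ^ 2 := sq_sqrt hs.le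
  have hd : ∀ θ ∈ Set.uIcc 0 (π / 2), HasDerivAt (fun θ => -(1 / k * arsinh (k / κ * cos θ)))
      (sin θ / √(1 - k ^ 2 * sin θ ^ 2)) θ := by
    intro θ _
    have hp := one_sub_sq_mul_sin_sq_pos hk hk' θ
    have h := ((((hasDerivAt_cos θ).const_mul (k / κ)).arsinh).const_mul (1 / k)).neg
    refine h.congr_deriv ?_
    have e : √(1 + (k / κ * cos θ) ^ 2) = √(1 - k ^ 2 * sin θ ^ 2) / κ := by
      rw [eq_div_iff hκ0.ne', ← sqrt_sq hκ0.le, ← sqrt_mul (by positivity), sqrt_sq hκ0.le]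
      congr 1
      field_simp
      rw [hκ2, cos_sq']
      ring
    rw [e]
    have := (sqrt_pos.2 hp).ne'
    simp only [smul_eq_mul]
    field_simp
  rw [intervalIntegral.integral_eq_sub_of_hasDerivAt hd]
  · have e : √(1 + (k / κ) ^ 2) = 1 / κ := by
      rw [eq_div_iff hκ0.ne', ← sqrt_sq hκ0.le, ← sqrt_mul (by positivity), sqrt_sq hκ0.le,
        sqrt_eq_one]
      field_simp
      rw [hκ2]
      ring
    rw [cos_pi_div_two, mul_zero, arsinh_zero, cos_zero, mul_one, arsinh, e]
    rw [mul_zero, neg_zero, sub_neg_eq_add, zero_add, add_comm (k / κ), add_div]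
  · refine Continuous.intervalIntegrable (continuous_sin.div (by fun_prop) fun θ => ?_) _ _
    exact (sqrt_pos.2 (one_sub_sq_mul_sin_sq_pos hk hk' θ)).ne'

lemma tendsto_integral_one_sub_sin_div_sqrt :
    Tendsto (fun k : ℝ => ∫ θ in (0 : ℝ)..(π / 2), (1 - sin θ) / √(1 - k ^ 2 * sin θ ^ 2))
      (𝓝[<] 1) (𝓝 (log 2)) := by
  have hI : ∫ θ in (0 : ℝ)..(π / 2), cos θ / (1 + sin θ) = log 2 := by
    have hpos : ∀ θ ∈ Set.uIcc 0 (π / 2), 1 + sin θ ≠ 0 := by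
      intro θ hθ
      rw [Set.uIcc_of_le (by positivity)] at hθ
      have := sin_nonneg_of_nonneg_of_le_pi hθ.1 (by linarith [hθ.2, pi_pos])
      positivity
    rw [intervalIntegral.integral_eq_sub_of_hasDerivAt
      (f := fun θ => log (1 + sin θ))
      (fun θ hθ => ((hasDerivAt_sin θ).const_add 1).log (hpos θ hθ))]
    · norm_num
    · exact (continuousOn_cos.div (by fun_prop) hpos).intervalIntegrable
  rw [← hI]
  have hev : ∀ᶠ k : ℝ in 𝓝[<] 1, 0 < k ∧ k < 1 := Ioo_mem_nhdsLT one_pos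
  refine intervalIntegral.tendsto_integral_filter_of_dominated_convergence (fun _ => 1)
    ?_ ?_ (by simp) ?_
  · filter_upwards [hev] with k ⟨hk, hk'⟩
    refine Continuous.aestronglyMeasurable (Continuous.div (by fun_prop) (by fun_prop) fun θ => ?_)
    exact (sqrt_pos.2 (one_sub_sq_mul_sin_sq_pos hk hk' θ)).ne'
  · filter_upwards [hev] with k ⟨hk, hk'⟩
    refine .of_forall fun θ hθ => ?_
    rw [Set.uIoc_of_le (by positivity)] at hθ
    have h0 := sin_nonneg_of_nonneg_of_le_pi hθ.1.le (by linarith [hθ.2, pi_pos])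
    have h1 := sin_le_one θ
    have hp := sqrt_pos.2 (one_sub_sq_mul_sin_sq_pos hk hk' θ)
    rw [norm_of_nonneg (by apply div_nonneg <;> linarith), div_le_one hp]
    apply le_sqrt_of_sq_le
    nlinarith [mul_nonneg h0 (sub_nonneg.2 h1), mul_nonneg (sq_nonneg (sin θ))
      (by nlinarith : 0 ≤ 1 - k ^ 2)]
  · have hne : ∀ᵐ θ : ℝ, θ ≠ π / 2 := by simp [ae_iff]
    filter_upwards [hne] with θ hθ' hθ
    rw [Set.uIoc_of_le (by positivity)] at hθ
    have hc : 0 < cos θ := cos_pos_of_mem_Ioo ⟨by linarith [hθ.1, pi_pos],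
      lt_of_le_of_ne hθ.2 hθ'⟩
    have h0 := sin_nonneg_of_nonneg_of_le_pi hθ.1.le (by linarith [hθ.2, pi_pos])
    have hs : √(1 - 1 ^ 2 * sin θ ^ 2) = cos θ := by
      rw [one_pow, one_mul, ← cos_sq', sqrt_sq hc.le]
    have e : cos θ / (1 + sin θ) = (1 - sin θ) / √(1 - 1 ^ 2 * sin θ ^ 2) := by
      rw [hs, div_eq_div_iff (by positivity) hc.ne']
      nlinarith [sin_sq_add_cos_sq θ]
    rw [e]
    refine Tendsto.mono_left ?_ nhdsWithin_le_nhds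
    refine ContinuousAt.tendsto (f := fun k : ℝ => (1 - sin θ) / √(1 - k ^ 2 * sin θ ^ 2)) ?_
    refine ContinuousAt.div (by fun_prop) (by fun_prop) ?_
    rw [hs]
    exact hc.ne'

lemma EllK_eq {k : ℝ} (hk : 0 < k) (hk' : k < 1) :
    EllK k = 1 / k * log ((1 + k) / √(1 - k ^ 2)) +
      ∫ θ in (0 : ℝ)..(π / 2), (1 - sin θ) / √(1 - k ^ 2 * sin θ ^ 2) := by
  have hc : ∀ θ, √(1 - k ^ 2 * sin θ ^ 2) ≠ 0 := fun θ =>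
    (sqrt_pos.2 (one_sub_sq_mul_sin_sq_pos hk hk' θ)).ne'
  rw [← integral_sin_div_sqrt hk hk', ← intervalIntegral.integral_add, EllK]
  · congr 1
    ext θ
    rw [← add_div]
    ring
  · exact (continuous_sin.div (by fun_prop) hc).intervalIntegrable _ _
  · exact (Continuous.div (by fun_prop) (by fun_prop) hc).intervalIntegrable _ _

lemma tendsto_one_sub_mul_log_sqrt :
    Tendsto (fun k : ℝ => (1 - k) * log (√(1 - k ^ 2))) (𝓝[<] 1) (𝓝 0) := by
  have h1 : Tendsto (fun k : ℝ => 1 - k) (𝓝[<] 1) (𝓝[>] 0) := by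
    refine tendsto_nhdsWithin_iff.2 ⟨?_, ?_⟩
    · have : Tendsto (fun k : ℝ => 1 - k) (𝓝 1) (𝓝 (1 - 1)) := Continuous.tendsto (by fun_prop) 1
      rw [sub_self] at this
      exact this.mono_left nhdsWithin_le_nhds
    · filter_upwards [self_mem_nhdsWithin] with k hk
      simpa using hk
  have h2 := (tendsto_log_mul_rpow_nhdsGT_zero one_pos).comp h1
  have h3 : Tendsto (fun k : ℝ => (1 - k) * log (1 + k)) (𝓝[<] 1) (𝓝 ((1 - 1) * log (1 + 1))) := by
    refine Tendsto.mono_left ?_ nhdsWithin_le_nhds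
    refine ContinuousAt.tendsto (f := fun k : ℝ => (1 - k) * log (1 + k)) ?_
    exact ContinuousAt.mul (by fun_prop) (ContinuousAt.log (by fun_prop) (by norm_num))
  have h4 := (h2.add h3).const_mul (1 / 2)
  simp only [sub_self, zero_mul, add_zero, mul_zero] at h4
  refine h4.congr' ?_
  filter_upwards [Ioo_mem_nhdsLT one_pos] with k ⟨hk, hk'⟩
  have : 1 - k ^ 2 = (1 - k) * (1 + k) := by ring
  rw [this, log_sqrt (by nlinarith), log_mul (by linarith) (by linarith)]
  simp only [Function.comp_apply, rpow_one]
  ring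

lemma tendsto_EllK_sub_log :
    Tendsto (fun k : ℝ => EllK k - log (4 / √(1 - k ^ 2))) (𝓝[<] 1) (𝓝 0) := by
  have hk1 : Tendsto (fun k : ℝ => k) (𝓝[<] 1) (𝓝 1) := nhdsWithin_le_nhds
  have hl : Tendsto (fun k : ℝ => log (1 + k)) (𝓝[<] 1) (𝓝 (log (1 + 1))) :=
    (hk1.const_add 1).log (by norm_num)
  have h := ((((hk1.const_sub 1).mul hl).sub tendsto_one_sub_mul_log_sqrt).div hk1 one_ne_zero).add
    ((hl.add tendsto_integral_one_sub_sin_div_sqrt).sub_const (log 4))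
  have h4 : log 4 = log 2 + log 2 := by
    rw [← log_mul (by norm_num) (by norm_num)]; norm_num
  have e : ((1 - 1) * log (1 + 1) - 0) / 1 + (log (1 + 1) + log 2 - log 4) = 0 := by
    rw [h4]; norm_num
  rw [e] at h
  refine h.congr' ?_
  filter_upwards [Ioo_mem_nhdsLT one_pos] with k ⟨hk, hk'⟩
  have hκ : 0 < √(1 - k ^ 2) := sqrt_pos.2 (by nlinarith)
  simp only [Pi.div_apply]
  rw [EllK_eq hk hk', log_div (by positivity) hκ.ne', log_div (by norm_num) hκ.ne']
  field_simp
  ring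

lemma hasDerivAt_cosKernel (a : ℝ) {s : ℝ} (hs : 0 < s) :
    HasDerivAt (fun a : ℝ => cosKernel a s) (-(2 * π) * sinKernel a s) a := by
  have hsum : Summable fun n : ℕ => 4 * π * ((n + 1 : ℕ) : ℝ) * rexp (-π * (n + 1 : ℕ) ^ 2 * s) := by
    have h := (summable_pow_mul_jacobiTheta₂_term_bound 0 hs 1).mul_left (4 * π)
    have h' := (h.comp_injective Nat.cast_injective).comp_injective
      (add_left_injective 1)
    refine h'.congr fun n => ?_
    simp only [Function.comp_apply, Int.cast_natCast, pow_one, Nat.abs_cast]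
    rw [mul_assoc (4 * π)]
    congr 3
    ring
  have h := hasDerivAt_tsum
    (g := fun (n : ℕ) (a : ℝ) => 2 * cos (2 * π * a * (n + 1)) * rexp (-π * (n + 1) ^ 2 * s))
    (g' := fun (n : ℕ) (a : ℝ) => -(2 * π) *
      (2 * (n + 1 : ℕ) * sin (2 * π * a * (n + 1 : ℕ)) * rexp (-π * (n + 1 : ℕ) ^ 2 * s)))
    hsum ?_ ?_ (hasSum_nat_cosKernel₀ a hs).summable a
  · have h1 := (hasSum_nat_add_iff' 1).2 (hasSum_nat_sinKernel a hs)
    simp only [Finset.sum_range_one, Nat.cast_zero, mul_zero, zero_mul, sub_zero] at h1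
    rw [(h1.mul_left _).tsum_eq] at h
    refine (h.const_add 1).congr_of_eventuallyEq (.of_forall fun b => ?_)
    beta_reduce
    rw [(hasSum_nat_cosKernel₀ b hs).tsum_eq]
    ring
  · intro n y
    have h := ((((hasDerivAt_id y).const_mul (2 * π)).mul_const ((n : ℝ) + 1)).cos.const_mul
      2).mul_const (rexp (-π * (n + 1) ^ 2 * s))
    refine h.congr_deriv ?_
    push_cast
    simp only [id]
    ring
  · intro n y
    rw [norm_mul, norm_mul, norm_mul, norm_neg, norm_of_nonneg (exp_nonneg _),
      norm_of_nonneg (by positivity : 0 ≤ 2 * π),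
      norm_of_nonneg (by positivity : (0 : ℝ) ≤ 2 * (n + 1 : ℕ)), norm_eq_abs]
    have := abs_sin_le_one (2 * π * y * (n + 1 : ℕ))
    calc _ ≤ 2 * π * (2 * (n + 1 : ℕ) * 1 * rexp (-π * (n + 1 : ℕ) ^ 2 * s)) := by gcongr
      _ = _ := by ring

lemma JTheta_eq_cosKernel (u : ℝ) {k : ℝ} (hK : 0 < EllK k) (hK' : 0 < EllK' k) :
    JTheta u k = cosKernel ((u / (2 * EllK k) - 1 / 2 : ℝ) : UnitAddCircle) (EllK' k / EllK k) := by
  have h := hasSum_nat_cosKernel₀ (u / (2 * EllK k) - 1 / 2) (div_pos hK' hK)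
  rw [JTheta, ← tsum_mul_left, eq_comm, ← sub_eq_iff_eq_add', ← h.tsum_eq]
  congr 1
  ext n
  have e : 2 * π * (u / (2 * EllK k) - 1 / 2) * (n + 1) =
      (n + 1) * π * u / EllK k - (n + 1 : ℕ) * π := by
    push_cast
    field_simp
  rw [e, cos_sub_nat_mul_pi, nome, ← exp_nat_mul]
  have e' : (((n + 1) ^ 2 : ℕ) : ℝ) * (-π * EllK' k / EllK k) =
      -π * (n + 1) ^ 2 * (EllK' k / EllK k) := by push_cast; ring
  rw [e']
  ring

lemma zn_eq_oddKernel_div_evenKernel (u : ℝ) {k : ℝ} (hK : 0 < EllK k) (hK' : 0 < EllK' k) :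
    zn u k = -(π / EllK' k) *
      (oddKernel ((u / (2 * EllK k) - 1 / 2 : ℝ) : UnitAddCircle) (EllK k / EllK' k) /
        evenKernel ((u / (2 * EllK k) - 1 / 2 : ℝ) : UnitAddCircle) (EllK k / EllK' k)) := by
  have ht : 0 < EllK k / EllK' k := div_pos hK hK'
  have hd : HasDerivAt (fun v : ℝ => v / (2 * EllK k) - 1 / 2) (1 / (2 * EllK k)) u :=
    ((hasDerivAt_id u).div_const _).sub_const _
  have h := (hasDerivAt_cosKernel (u / (2 * EllK k) - 1 / 2) (div_pos hK' hK)).comp u hd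
  have hfun : (fun v => JTheta v k) =
      (fun a : ℝ => cosKernel a (EllK' k / EllK k)) ∘ fun v : ℝ => v / (2 * EllK k) - 1 / 2 :=
    funext fun v => JTheta_eq_cosKernel v hK hK'
  rw [zn, hfun, h.deriv, JTheta_eq_cosKernel u hK hK', oddKernel_functional_equation,
    evenKernel_functional_equation, one_div_div]
  have e : (EllK k / EllK' k) ^ (3 / 2 : ℝ) =
      EllK k / EllK' k * (EllK k / EllK' k) ^ (1 / 2 : ℝ) := by
    rw [show (3 / 2 : ℝ) = 1 + 1 / 2 by norm_num, rpow_add ht, rpow_one]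
  rw [e]
  have := (rpow_pos_of_pos ht (1 / 2)).ne'
  set c := cosKernel ((u / (2 * EllK k) - 1 / 2 : ℝ) : UnitAddCircle) (EllK' k / EllK k)
  rcases eq_or_ne c 0 with hc | hc
  · simp [hc]
  · generalize (EllK k / EllK' k) ^ (1 / 2 : ℝ) = r at *
    field_simp

lemma summable_abs_mul_exp_neg_quadratic (b : ℝ) (j : ℕ) :
    Summable fun m : ℤ => (|m| ^ j : ℝ) * rexp (-π * (m * (m - b))) := by
  refine (summable_pow_mul_jacobiTheta₂_term_bound (|b| / 2) one_pos j).of_nonneg_of_le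
    (fun m => by positivity) fun m => ?_
  have hb : (m : ℝ) * b ≤ |b| * |(m : ℝ)| := by
    rw [mul_comm, ← abs_mul]
    exact le_abs_self _
  refine mul_le_mul_of_nonneg_left (exp_le_exp.2 ?_) (by positivity)
  rw [Int.cast_abs]
  nlinarith [pi_pos]

lemma tendsto_exp_neg_pi_mul_mul {c : ℝ} (hc : 0 < c) :
    Tendsto (fun t : ℝ => rexp (-π * c * t)) atTop (𝓝 0) := by
  refine tendsto_exp_atBot.comp (tendsto_id.const_mul_atTop_of_neg ?_)
  nlinarith [pi_pos]

lemma tendsto_tsum_exp_neg_quadratic {b : ℝ} (hb : 0 < b) (hb' : b < 1) :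
    Tendsto (fun t : ℝ => ∑' m : ℤ, rexp (-π * (m * (m - b)) * t)) atTop (𝓝 1) := by
  have hpos : ∀ m : ℤ, m ≠ 0 → 0 < (m : ℝ) * (m - b) := by
    intro m hm
    rcases lt_or_gt_of_ne hm with h | h
    · have : (m : ℝ) < 0 := by exact_mod_cast h
      nlinarith
    · have : (1 : ℝ) ≤ m := by exact_mod_cast h
      nlinarith
  rw [← tsum_ite_eq (0 : ℤ) (fun _ => (1 : ℝ))]
  refine tendsto_tsum_of_dominated_convergence (summable_abs_mul_exp_neg_quadratic b 0)
    (fun m => ?_) ?_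
  · split_ifs with hm
    · simp [hm]
    · exact tendsto_exp_neg_pi_mul_mul (hpos m hm)
  · filter_upwards [eventually_ge_atTop 1] with t ht m
    rw [norm_of_nonneg (exp_nonneg _), pow_zero, one_mul, exp_le_exp]
    have : 0 ≤ (m : ℝ) * (m - b) := by
      rcases eq_or_ne m 0 with rfl | hm
      · simp
      · exact (hpos m hm).le
    nlinarith [mul_nonneg pi_pos.le this]

lemma tendsto_tsum_mul_exp_neg_quadratic {b : ℝ} (hb : 0 < b) (hb' : b < 1) :
    Tendsto (fun t : ℝ => ∑' m : ℤ, (m : ℝ) * rexp (-π * (m * (m - b) - (1 - b)) * t))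
      atTop (𝓝 1) := by
  have hpos : ∀ m : ℤ, m ≠ 0 → m ≠ 1 → 0 < (m : ℝ) * (m - b) - (1 - b) := by
    intro m hm hm1
    rcases lt_or_gt_of_ne hm with h | h
    · have : (m : ℝ) ≤ -1 := by exact_mod_cast (by omega : m ≤ -1)
      nlinarith
    · have : (2 : ℝ) ≤ m := by exact_mod_cast (by omega : 2 ≤ m)
      nlinarith
  have h1 := tsum_ite_eq (1 : ℤ) (fun _ => (1 : ℝ))
  suffices Tendsto (fun t : ℝ => ∑' m : ℤ, (m : ℝ) * rexp (-π * (m * (m - b) - (1 - b)) * t))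
      atTop (𝓝 (∑' m : ℤ, if m = 1 then 1 else 0)) by rwa [h1] at this
  refine tendsto_tsum_of_dominated_convergence
    ((summable_abs_mul_exp_neg_quadratic b 1).mul_left (rexp (π * (1 - b)))) (fun m => ?_) ?_
  · split_ifs with hm
    · simp [hm]
    · rcases eq_or_ne m 0 with rfl | hm0
      · simp
      · simpa using (tendsto_exp_neg_pi_mul_mul (hpos m hm0 hm)).const_mul (m : ℝ)
  · filter_upwards [eventually_ge_atTop 1] with t ht m
    rcases eq_or_ne m 0 with rfl | hm0
    · simp
    have : 0 ≤ (m : ℝ) * (m - b) - (1 - b) := by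
      rcases eq_or_ne m 1 with rfl | hm
      · simp
      · exact (hpos m hm0 hm).le
    rw [norm_mul, norm_of_nonneg (exp_nonneg _), norm_eq_abs, pow_one, mul_left_comm, ← exp_add,
      Int.cast_abs]
    refine mul_le_mul_of_nonneg_left (exp_le_exp.2 ?_) (abs_nonneg _)
    nlinarith [mul_nonneg pi_pos.le this]

lemma tendsto_oddKernel_div_evenKernel {b : ℝ} (hb : 0 < b) (hb' : b < 1) :
    Tendsto (fun t : ℝ => (b + 2 * (oddKernel ((-b / 2 : ℝ) : UnitAddCircle) t /
        evenKernel ((-b / 2 : ℝ) : UnitAddCircle) t)) / rexp (-π * (1 - b) * t))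
      atTop (𝓝 2) := by
  have h := ((tendsto_tsum_mul_exp_neg_quadratic hb hb').div
    (tendsto_tsum_exp_neg_quadratic hb hb') one_ne_zero).const_mul 2
  rw [div_one, mul_one] at h
  refine h.congr' ?_
  filter_upwards [eventually_gt_atTop 0,
    (tendsto_tsum_exp_neg_quadratic hb hb').eventually_ne one_ne_zero] with t ht hne
  have he := hasSum_int_evenKernel (-b / 2) ht
  have ho := hasSum_int_oddKernel (-b / 2) ht
  have he' : ∑' m : ℤ, rexp (-π * (m * (m - b)) * t) =
      rexp (π * (b / 2) ^ 2 * t) * evenKernel ((-b / 2 : ℝ) : UnitAddCircle) t := by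
    rw [← (he.mul_left _).tsum_eq]
    congr 1
    ext m
    rw [← exp_add]
    congr 1
    ring
  have ho' : ∑' m : ℤ, (m : ℝ) * rexp (-π * (m * (m - b) - (1 - b)) * t) =
      rexp (π * (b / 2) ^ 2 * t) / rexp (-π * (1 - b) * t) *
        (oddKernel ((-b / 2 : ℝ) : UnitAddCircle) t +
        b / 2 * evenKernel ((-b / 2 : ℝ) : UnitAddCircle) t) := by
    rw [← ((ho.add (he.mul_left (b / 2))).mul_left _).tsum_eq]
    congr 1
    ext m
    rw [← add_mul, ← exp_sub, mul_left_comm, ← exp_add]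
    congr 1
    · ring
    · congr 1
      ring
  simp only [Pi.div_apply]
  rw [he'] at hne
  rw [he', ho']
  have hE := right_ne_zero_of_mul hne
  have := (exp_pos (π * (b / 2) ^ 2 * t)).ne'
  have := (exp_pos (-π * (1 - b) * t)).ne'
  generalize rexp (π * (b / 2) ^ 2 * t) = r at *
  generalize rexp (-π * (1 - b) * t) = s at *
  generalize evenKernel ((-b / 2 : ℝ) : UnitAddCircle) t = x at *
  generalize oddKernel ((-b / 2 : ℝ) : UnitAddCircle) t = y at *
  field_simp
  ring

lemma EllK'_bounds {k : ℝ} (hk : 0 < k) (hk' : k < 1) :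
    k ≤ π / 2 / EllK' k ∧ π / 2 / EllK' k ≤ 1 ∧ 0 < EllK' k := by
  have hκ0 : 0 < √(1 - k ^ 2) := sqrt_pos.2 (by nlinarith)
  have hκ1 : √(1 - k ^ 2) < 1 := (sqrt_lt' one_pos).2 (by nlinarith)
  have h1 : π / 2 ≤ EllK' k := pi_div_two_le_EllK hκ0 hκ1
  have h2 : EllK' k ≤ π / 2 / √(1 - √(1 - k ^ 2) ^ 2) := EllK_le hκ0 hκ1
  rw [sq_sqrt (by nlinarith), sub_sub_cancel, sqrt_sq hk.le, le_div_iff₀ hk] at h2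
  have h0 : 0 < EllK' k := lt_of_lt_of_le (by positivity) h1
  exact ⟨by rw [le_div_iff₀ h0]; linarith, by rwa [div_le_one h0], h0⟩

lemma tendsto_sqrt_one_sub_sq :
    Tendsto (fun k : ℝ => √(1 - k ^ 2)) (𝓝[<] 1) (𝓝 0) := by
  have h : Tendsto (fun k : ℝ => √(1 - k ^ 2)) (𝓝 1) (𝓝 √(1 - 1 ^ 2)) :=
    Continuous.tendsto (by fun_prop) 1
  simp only [one_pow, sub_self, sqrt_zero] at h
  exact h.mono_left nhdsWithin_le_nhds

lemma tendsto_pi_div_two_div_EllK' :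
    Tendsto (fun k : ℝ => π / 2 / EllK' k) (𝓝[<] 1) (𝓝 1) := by
  refine tendsto_of_tendsto_of_tendsto_of_le_of_le' (g := fun k => k) (h := fun _ => 1)
    nhdsWithin_le_nhds tendsto_const_nhds ?_ ?_
  all_goals
    filter_upwards [Ioo_mem_nhdsLT one_pos] with k ⟨hk, hk'⟩
  exacts [(EllK'_bounds hk hk').1, (EllK'_bounds hk hk').2.1]

/-- The complementary nome is asymptotic to `(1 - k²) / 16` as `k → 1`. -/
lemma tendsto_pi_mul_EllK_div_EllK'_sub_log :
    Tendsto (fun k : ℝ => π * (EllK k / EllK' k) - 2 * log (4 / √(1 - k ^ 2)))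
      (𝓝[<] 1) (𝓝 0) := by
  have hk1 : Tendsto (fun k : ℝ => k) (𝓝[<] 1) (𝓝 1) := nhdsWithin_le_nhds
  have hb : Tendsto (fun k : ℝ => (1 - k) * log 4 - (1 - k) * log (√(1 - k ^ 2)))
      (𝓝[<] 1) (𝓝 ((1 - 1) * log 4 - 0)) :=
    ((hk1.const_sub 1).mul_const _).sub tendsto_one_sub_mul_log_sqrt
  rw [sub_self, zero_mul, sub_zero] at hb
  have hc : Tendsto (fun k : ℝ => (1 - π / 2 / EllK' k) * log (4 / √(1 - k ^ 2)))
      (𝓝[<] 1) (𝓝 0) := by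
    refine squeeze_zero' ?_ ?_ hb
    all_goals
      filter_upwards [Ioo_mem_nhdsLT one_pos] with k ⟨hk, hk'⟩
      obtain ⟨h1, h2, -⟩ := EllK'_bounds hk hk'
      have hκ0 : 0 < √(1 - k ^ 2) := sqrt_pos.2 (by nlinarith)
      have hκ1 : √(1 - k ^ 2) < 1 := (sqrt_lt' one_pos).2 (by nlinarith)
      have hl : 0 ≤ log (4 / √(1 - k ^ 2)) :=
        log_nonneg (by rw [le_div_iff₀ hκ0]; linarith)
    · exact mul_nonneg (by linarith) hl
    · rw [← mul_sub, ← log_div (by norm_num) hκ0.ne']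
      exact mul_le_mul_of_nonneg_right (by linarith) hl
  have h := ((tendsto_pi_div_two_div_EllK'.mul tendsto_EllK_sub_log).sub hc).const_mul 2
  rw [mul_zero, sub_zero, mul_zero] at h
  refine h.congr fun k => ?_
  ring

lemma tendsto_EllK_div_EllK' :
    Tendsto (fun k : ℝ => EllK k / EllK' k) (𝓝[<] 1) atTop := by
  have hκ : Tendsto (fun k : ℝ => √(1 - k ^ 2)) (𝓝[<] 1) (𝓝[>] 0) := by
    refine tendsto_nhdsWithin_iff.2 ⟨tendsto_sqrt_one_sub_sq, ?_⟩
    filter_upwards [Ioo_mem_nhdsLT one_pos] with k ⟨hk, hk'⟩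
    exact sqrt_pos.2 (by nlinarith)
  have hl : Tendsto (fun k : ℝ => 2 * log (4 / √(1 - k ^ 2))) (𝓝[<] 1) atTop := by
    refine (tendsto_log_atTop.comp ?_).const_mul_atTop two_pos
    simp only [div_eq_mul_inv]
    exact (tendsto_inv_nhdsGT_zero.comp hκ).const_mul_atTop (by norm_num)
  have h := (tendsto_pi_mul_EllK_div_EllK'_sub_log.add_atTop hl).const_mul_atTop
    (inv_pos.2 pi_pos)
  refine h.congr fun k => ?_
  rw [sub_add_cancel, inv_mul_cancel_left₀ pi_ne_zero]

theorem stmt_12 (lam : ℝ) (hlam : 0 < lam) (hlam' : lam < 1) :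
    Filter.Tendsto (fun k : ℝ =>
        ((1 - lam) - zn (lam * EllK k) k) / (2 * (Real.sqrt (1 - k^2) / 4) ^ (2 * lam)))
      (nhdsWithin 1 (Set.Iio (1:ℝ))) (nhds 1) := by
  have hG := (tendsto_oddKernel_div_evenKernel (b := 1 - lam) (by linarith) (by linarith)).comp
    tendsto_EllK_div_EllK'
  have hR : Tendsto (fun k : ℝ => rexp (-lam *
      (π * (EllK k / EllK' k) - 2 * log (4 / √(1 - k ^ 2))))) (𝓝[<] 1) (𝓝 1) := by
    have := (tendsto_pi_mul_EllK_div_EllK'_sub_log.const_mul (-lam)).rexp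
    rwa [mul_zero, exp_zero] at this
  have hP : Tendsto (fun k : ℝ => (1 - π / 2 / EllK' k) / (√(1 - k ^ 2) / 4) ^ (2 * lam))
      (𝓝[<] 1) (𝓝 0) := by
    have hb := ((tendsto_sqrt_one_sub_sq.div_const 4).rpow_const
      (p := 2 - 2 * lam) (Or.inr (by linarith))).const_mul 16
    rw [zero_div, zero_rpow (by linarith), mul_zero] at hb
    refine squeeze_zero' ?_ ?_ hb
    all_goals
      filter_upwards [Ioo_mem_nhdsLT one_pos] with k ⟨hk, hk'⟩
      obtain ⟨h1, h2, -⟩ := EllK'_bounds hk hk'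
      have hκ0 : 0 < √(1 - k ^ 2) := sqrt_pos.2 (by nlinarith)
    · exact div_nonneg (by linarith) (by positivity)
    · rw [rpow_sub (by positivity), ← mul_div_assoc]
      refine div_le_div_of_nonneg_right ?_ (by positivity)
      rw [rpow_two, div_pow, sq_sqrt (by nlinarith)]
      nlinarith
  have h := (hP.const_mul ((1 - lam) / 2)).add
    (((tendsto_pi_div_two_div_EllK'.mul hG).mul hR).div_const 2)
  rw [mul_zero, one_mul, mul_one, div_self two_ne_zero, zero_add] at h
  refine h.congr' ?_
  filter_upwards [Ioo_mem_nhdsLT one_pos] with k ⟨hk, hk'⟩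
  obtain ⟨-, -, hK'⟩ := EllK'_bounds hk hk'
  have hK : 0 < EllK k := lt_of_lt_of_le (by positivity) (pi_div_two_le_EllK hk hk')
  have hκ0 : 0 < √(1 - k ^ 2) := sqrt_pos.2 (by nlinarith)
  have ha : lam * EllK k / (2 * EllK k) - 1 / 2 = -(1 - lam) / 2 := by
    field_simp
    ring
  have hexp : rexp (-lam * (π * (EllK k / EllK' k) - 2 * log (4 / √(1 - k ^ 2)))) =
      rexp (-π * (1 - (1 - lam)) * (EllK k / EllK' k)) / (√(1 - k ^ 2) / 4) ^ (2 * lam) := by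
    rw [rpow_def_of_pos (by positivity), ← exp_sub, ← inv_div (√(1 - k ^ 2)), log_inv]
    congr 1
    ring
  rw [zn_eq_oddKernel_div_evenKernel _ hK hK', ha, hexp]
  simp only [Function.comp_apply]
  have hw : (√(1 - k ^ 2) / 4) ^ (2 * lam) ≠ 0 := (rpow_pos_of_pos (by positivity) _).ne'
  have hr := (exp_pos (-π * (1 - (1 - lam)) * (EllK k / EllK' k))).ne'
  generalize (√(1 - k ^ 2) / 4) ^ (2 * lam) = w at *
  generalize rexp (-π * (1 - (1 - lam)) * (EllK k / EllK' k)) = r at *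
  generalize oddKernel _ _ / evenKernel _ _ = g at *
  field_simp
  ring
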